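/- arXiv:2404.10491 — 9 statements merged into one kernel-verified Lean document; each statement's English description precedes it below -/
import Mathlib

section
/- Suppose v = (ℓ, lbase, lspan, base, span) and v' = (ℓ, lbase, lspan, base, span') are rival nonterminal nodes (so span ≠ span') with lspan even, and suppose span = H(span_L, span_R) and span' = H(span'_L, span'_R) for some span_L, span_R, span'_L, span'_R ∈ X. Let v_L, v_R be the left and right children produced by bisecting v with (span_L, span_R), and v'_L, v'_R those produced by bisecting v' with (span'_L, span'_R). Then v_L and v'_L are rivals, or v_R and v'_R are rivals. -/
/-- A node of the BoLD protocol graph: level, base length, span length,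
base commitment, and span commitment. -/
structure Node (X : Type) where
  level : ℕ
  lbase : ℕ
  lspan : ℕ
  base : X
  span : X

/-- The context of a node: everything but the span commitment. -/
def Node.context {X : Type} (v : Node X) : ℕ × ℕ × ℕ × X :=
  (v.level, v.lbase, v.lspan, v.base)

/-- Two nodes are rivals if they are distinct but share the same context. -/
def Rivals {X : Type} (v v' : Node X) : Prop :=
  v ≠ v' ∧ v.context = v'.context

/-- The left child produced by bisecting `v` with left span commitment `spanL`. -/
def leftChild {X : Type} (v : Node X) (spanL : X) : Node X :=
  ⟨v.level, v.lbase, v.lspan / 2, v.base, spanL⟩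

/-- The right child produced by bisecting `v` with span commitments `spanL`, `spanR`. -/
def rightChild {X : Type} (H : X × X → X) (v : Node X) (spanL spanR : X) : Node X :=
  ⟨v.level, v.lbase + v.lspan / 2, v.lspan / 2, H (v.base, spanL), spanR⟩

theorem stmt0 {X : Type} (H : X × X → X)
    (ℓ lbase lspan : ℕ) (base span span' spanL spanR spanL' spanR' : X)
    (hnonterminal : 1 < lspan) (heven : 2 ∣ lspan)
    (hrival : Rivals (⟨ℓ, lbase, lspan, base, span⟩ : Node X)
      (⟨ℓ, lbase, lspan, base, span'⟩ : Node X))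
    (hspan : span = H (spanL, spanR)) (hspan' : span' = H (spanL', spanR')) :
    Rivals (leftChild (⟨ℓ, lbase, lspan, base, span⟩ : Node X) spanL)
        (leftChild (⟨ℓ, lbase, lspan, base, span'⟩ : Node X) spanL') ∨
    Rivals (rightChild H (⟨ℓ, lbase, lspan, base, span⟩ : Node X) spanL spanR)
        (rightChild H (⟨ℓ, lbase, lspan, base, span'⟩ : Node X) spanL' spanR') := by
  by_cases h : spanL = spanL'
  · right
    subst h
    refine ⟨fun e => hrival.1 ?_, rfl⟩
    have e2 : spanR = spanR' := congrArg Node.span e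
    rw [hspan, hspan', e2]
  · left
    exact ⟨fun e => h (congrArg Node.span e), rfl⟩
end

section
/- Assume H is injective. Suppose v = (ℓ, lbase, lspan, base, span) and v' = (ℓ, lbase, lspan, base, span') are rival nonterminal nodes (so span ≠ span') with lspan even, and suppose span = H(span_L, span_R) and span' = H(span'_L, span'_R). Let v_L, v_R be the left and right children produced by bisecting v with (span_L, span_R), and v'_L, v'_R those produced by bisecting v' with (span'_L, span'_R). Then exactly one of the following holds: (a) v_L and v'_L are rivals; (b) v_R and v'_R are rivals. -/
theorem stmt1 {X : Type} (H : X × X → X) (hH : Function.Injective H)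
    (ℓ lbase lspan : ℕ) (base span span' spanL spanR spanL' spanR' : X)
    (hnonterminal : 1 < lspan) (heven : 2 ∣ lspan)
    (hrival : Rivals (⟨ℓ, lbase, lspan, base, span⟩ : Node X)
      (⟨ℓ, lbase, lspan, base, span'⟩ : Node X))
    (hspan : span = H (spanL, spanR)) (hspan' : span' = H (spanL', spanR')) :
    Xor'
      (Rivals (leftChild (⟨ℓ, lbase, lspan, base, span⟩ : Node X) spanL)
        (leftChild (⟨ℓ, lbase, lspan, base, span'⟩ : Node X) spanL'))
      (Rivals (rightChild H (⟨ℓ, lbase, lspan, base, span⟩ : Node X) spanL spanR)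
        (rightChild H (⟨ℓ, lbase, lspan, base, span'⟩ : Node X) spanL' spanR')) := by
  subst hspan hspan'
  simp only [Rivals, Node.context, leftChild, rightChild, ne_eq, Node.mk.injEq, Prod.mk.injEq,
    hH.eq_iff, Xor', true_and, and_true] at hrival ⊢
  tauto
end

section
/- Assume H is injective. Let v and v' be nonterminal nodes whose lspan values are even and divide their respective lbase values. Let w be a bisection child (left or right) of v and let w' be a bisection child (left or right) of v'. If w and w' have the same context, then v and v' have the same context. -/
/-- `w` is a bisection child (left or right) of the nonterminal node `v`. -/
def IsChild {X : Type} (H : X × X → X) (w v : Node X) : Prop :=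
  1 < v.lspan ∧ ∃ spanL spanR, v.span = H (spanL, spanR) ∧
    (w = leftChild v spanL ∨ w = rightChild H v spanL spanR)

theorem stmt2 {X : Type} (H : X × X → X) (hH : Function.Injective H)
    (v v' w w' : Node X)
    (hv : 1 < v.lspan) (hv' : 1 < v'.lspan)
    (heven : 2 ∣ v.lspan) (heven' : 2 ∣ v'.lspan)
    (hdvd : v.lspan ∣ v.lbase) (hdvd' : v'.lspan ∣ v'.lbase)
    (hw : IsChild H w v) (hw' : IsChild H w' v')
    (hctx : w.context = w'.context) :
    v.context = v'.context := by
  obtain ⟨-, a, b, -, hc⟩ := hw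
  obtain ⟨-, a', b', -, hc'⟩ := hw'
  have key : ∀ s x y : ℕ, 1 < s → 2 ∣ s → s ∣ x → s ∣ y → x = y + s / 2 → False := by
    intro s x y h1 h2 hx hy e
    have h3 : s ∣ s / 2 := (Nat.dvd_add_right hy).1 (e ▸ hx)
    have := Nat.le_of_dvd (by omega) h3
    omega
  obtain ⟨l, x, s, c, d⟩ := v
  obtain ⟨l', x', s', c', d'⟩ := v'
  rcases hc with rfl | rfl <;> rcases hc' with rfl | rfl <;>
    simp only [Node.context, leftChild, rightChild, Prod.mk.injEq] at * <;>
    obtain ⟨h1, h2, h3, h4⟩ := hctx <;>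
    obtain rfl : s = s' := by omega
  · exact ⟨h1, h2, rfl, h4⟩
  · exact (key s x x' hv heven hdvd hdvd' h2).elim
  · exact (key s x' x hv heven hdvd' hdvd h2.symm).elim
  · have := hH h4
    simp only [Prod.mk.injEq] at this
    exact ⟨h1, by omega, rfl, this.1⟩
end

section
/- Assume H is injective. Let v and v' be nonterminal nodes whose lspan values are even and divide their respective lbase values. Let w be a bisection child (left or right) of v and let w' be a bisection child (left or right) of v'. If w and w' are rivals, then v and v' are rivals. -/
theorem stmt3 {X : Type} (H : X × X → X) (hH : Function.Injective H)
    (v v' w w' : Node X)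
    (hv : 1 < v.lspan) (hv' : 1 < v'.lspan)
    (heven : 2 ∣ v.lspan) (heven' : 2 ∣ v'.lspan)
    (hdvd : v.lspan ∣ v.lbase) (hdvd' : v'.lspan ∣ v'.lbase)
    (hw : IsChild H w v) (hw' : IsChild H w' v')
    (hriv : Rivals w w') :
    Rivals v v' := by
  have key : ∀ s a b : ℕ, 1 < s → s ∣ a → s ∣ b → a = b + s / 2 → False := by
    intro s a b h1 h2 h3 h4
    have h5 : s ∣ s / 2 := (Nat.dvd_add_right h3).1 (h4 ▸ h2)
    have := Nat.le_of_dvd (by omega) h5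
    omega
  obtain ⟨l, b, s, x, y⟩ := v
  obtain ⟨l', b', s', x', y'⟩ := v'
  obtain ⟨-, p, q, hy, hw⟩ := hw
  obtain ⟨-, p', q', hy', hw'⟩ := hw'
  obtain ⟨hne, hc⟩ := hriv
  simp only at hv hv' heven heven' hdvd hdvd' hy hy'
  subst hy hy'
  have hs : s / 2 = s' / 2 → s = s' := by omega
  rcases hw with rfl | rfl <;> rcases hw' with rfl | rfl <;>
    simp only [leftChild, rightChild, Node.context, Prod.mk.injEq] at hc <;>
    obtain ⟨rfl, hb, h2, hx⟩ := hc <;> obtain rfl := hs h2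
  · subst hb hx
    refine ⟨fun h => hne ?_, rfl⟩
    have h1 := hH (Node.mk.inj h).2.2.2.2
    simp only [Prod.mk.injEq] at h1
    simp [leftChild, h1.1]
  · exact (key s b b' hv hdvd hdvd' hb).elim
  · exact (key s b' b hv hdvd' hdvd hb.symm).elim
  · have hb2 : b = b' := by omega
    have h3 := hH hx
    simp only [Prod.mk.injEq] at h3
    obtain ⟨rfl, rfl⟩ := h3
    subst hb2
    refine ⟨fun h => hne ?_, rfl⟩
    have h1 := hH (Node.mk.inj h).2.2.2.2
    simp only [Prod.mk.injEq] at h1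
    simp [rightChild, h1.2]
end

section
/- Assume H is injective. Let (v_0, v_1, ..., v_m) and (v'_0, v'_1, ..., v'_m) be two sequences of nodes of the same length m ≥ 0 such that for each i < m, v_{i+1} is a bisection child of v_i and v'_{i+1} is a bisection child of v'_i, where every node in both sequences has lspan a power of two dividing its lbase. If v_m = v'_m, then v_0 and v'_0 have the same context. -/
theorem step_context {X : Type} (H : X × X → X) (hH : Function.Injective H)
    (p p' c c' : Node X) (hc : IsChild H c p) (hc' : IsChild H c' p')
    (hp : (∃ k, p.lspan = 2 ^ k) ∧ p.lspan ∣ p.lbase)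
    (hp' : (∃ k, p'.lspan = 2 ^ k) ∧ p'.lspan ∣ p'.lbase)
    (h : c.context = c'.context) : p.context = p'.context := by
  have key : ∀ q : Node X, 1 < q.lspan → (∃ k, q.lspan = 2 ^ k) →
      ∃ s, 0 < s ∧ q.lspan = 2 * s := by
    rintro q hq ⟨k, hk⟩
    cases k with
    | zero => simp at hk; omega
    | succ k => exact ⟨2 ^ k, by positivity, by rw [hk, pow_succ]; ring⟩
  obtain ⟨h1, a, b, -, hc⟩ := hc
  obtain ⟨h1', a', b', -, hc'⟩ := hc'
  obtain ⟨s, hs, e⟩ := key p h1 hp.1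
  obtain ⟨s', hs', e'⟩ := key p' h1' hp'.1
  have d := hp.2
  have d' := hp'.2
  have e2 : p.lspan / 2 = s := by omega
  have e2' : p'.lspan / 2 = s' := by omega
  have par : ∀ x y : ℕ, 2 * s ∣ x → 2 * s ∣ y → x ≠ y + s := by
    rintro x y hx hy rfl
    have := Nat.le_of_dvd hs ((Nat.dvd_add_right hy).1 hx)
    omega
  rcases hc with rfl | rfl <;> rcases hc' with rfl | rfl <;>
    simp only [Node.context, leftChild, rightChild, Prod.mk.injEq, e2, e2'] at h ⊢ <;>
    obtain ⟨hl, hb, hsp, hbase⟩ := h <;> subst hsp <;> rw [e] at d <;> rw [e'] at d'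
  · exact ⟨hl, hb, by omega, hbase⟩
  · exact absurd hb (par _ _ d d')
  · exact absurd hb.symm (par _ _ d' d)
  · exact ⟨hl, by omega, by omega, (Prod.mk.inj (hH hbase)).1⟩

theorem stmt4 {X : Type} (H : X × X → X) (hH : Function.Injective H)
    (m : ℕ) (v v' : ℕ → Node X)
    (hchild : ∀ i < m, IsChild H (v (i + 1)) (v i))
    (hchild' : ∀ i < m, IsChild H (v' (i + 1)) (v' i))
    (hpow : ∀ i ≤ m, (∃ k, (v i).lspan = 2 ^ k) ∧ (v i).lspan ∣ (v i).lbase)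
    (hpow' : ∀ i ≤ m, (∃ k, (v' i).lspan = 2 ^ k) ∧ (v' i).lspan ∣ (v' i).lbase)
    (hend : v m = v' m) :
    (v 0).context = (v' 0).context := by
  have main : ∀ j ≤ m, (v (m - j)).context = (v' (m - j)).context := by
    intro j
    induction j with
    | zero => intro _; simp [hend]
    | succ j ih =>
      intro hj
      have hi := ih (by omega)
      have e : m - j = m - (j + 1) + 1 := by omega
      rw [e] at hi
      exact step_context H hH _ _ _ _ (hchild _ (by omega)) (hchild' _ (by omega))
        (hpow _ (by omega)) (hpow' _ (by omega)) hi
  simpa using main m le_rfl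
end

section
/- For every node v ∈ V, β(v) equals the minimum over all term-complete paths P starting at v of the quantity ω_P + max{β(x) : x a child of the last node of P}, where the maximum is taken to be 0 if the last node of P has no children. -/
theorem stmt10 {V : Type*} [Fintype V] (child : V → V → Prop) (terminal : V → Prop)
    (hwf : WellFounded fun w v => child v w)
    (lam beta : V → ℕ∞)
    -- `beta` satisfies the defining recursion of the bottom-up timer
    -- in the multi-level (leveled) setting:
    (hleaf : ∀ v, (¬ ∃ w, child v w) → beta v = lam v)
    (hterm : ∀ v, terminal v → (∃ w, child v w) →
      beta v = lam v + sSup {b | ∃ w, child v w ∧ b = beta w})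
    (hnonterm : ∀ v, ¬ terminal v → (∃ w, child v w) →
      beta v = lam v + sInf {b | ∃ w, child v w ∧ b = beta w}) :
    -- `beta v` is the minimum, over all term-complete paths `p` starting at `v`,
    -- of the weight of `p` plus the maximum of `beta` over the children of the
    -- last node of `p` (taken to be `0` when there are no children, since
    -- `sSup ∅ = 0` in `ℕ∞`)
    ∀ v : V, beta v =
      sInf {b | ∃ p : List V, p ≠ [] ∧ p.head? = some v ∧ p.Chain' child ∧
        (∀ u ∈ p.dropLast, ¬ terminal u) ∧
        (∀ u, p.getLast? = some u → terminal u ∨ ∀ w, ¬ child u w) ∧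
        b = (p.map lam).sum +
          sSup {c | ∃ u, p.getLast? = some u ∧ ∃ x, child u x ∧ c = beta x}} := by
  have hend : ∀ v, (terminal v ∨ ∀ w, ¬ child v w) →
      beta v = lam v + sSup {c | ∃ x, child v x ∧ c = beta x} := by
    intro v hv
    by_cases hc : ∃ w, child v w
    · rcases hv with hv | hv
      · exact hterm v hv hc
      · obtain ⟨w, hw⟩ := hc
        exact absurd hw (hv w)
    · have he : {c | ∃ x, child v x ∧ c = beta x} = (∅ : Set ℕ∞) := by
        ext c
        simp only [Set.mem_setOf_eq, Set.mem_empty_iff_false, iff_false]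
        rintro ⟨x, hx, _⟩
        exact hc ⟨x, hx⟩
      rw [he, hleaf v hc, sSup_empty]
      simp
  have hlow : ∀ (l : List V) (v : V), List.IsChain child (v :: l) →
      (∀ u ∈ (v :: l).dropLast, ¬ terminal u) →
      (∀ u, (v :: l).getLast? = some u → terminal u ∨ ∀ w, ¬ child u w) →
      beta v ≤ ((v :: l).map lam).sum +
        sSup {c | ∃ u, (v :: l).getLast? = some u ∧ ∃ x, child u x ∧ c = beta x} := by
    intro l
    induction l with
    | nil =>
      intro v _ _ h3
      have := hend v (h3 v (by simp))
      rw [this]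
      simp
    | cons w l ih =>
      intro v h1 h2 h3
      rw [List.isChain_cons_cons] at h1
      have hv : ¬ terminal v := h2 v (by simp)
      have := ih w h1.2 (fun u hu => h2 u (by
        rw [List.dropLast_cons_cons]; exact List.mem_cons_of_mem _ hu))
        (fun u hu => h3 u (by rw [List.getLast?_cons_cons]; exact hu))
      rw [hnonterm v hv ⟨w, h1.1⟩, List.map_cons, List.sum_cons, add_assoc,
        List.getLast?_cons_cons]
      exact add_le_add le_rfl (le_trans (sInf_le ⟨w, h1.1, rfl⟩) this)
  have hatt : ∀ v, ∃ l : List V, List.IsChain child (v :: l) ∧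
      (∀ u ∈ (v :: l).dropLast, ¬ terminal u) ∧
      (∀ u, (v :: l).getLast? = some u → terminal u ∨ ∀ w, ¬ child u w) ∧
      beta v = ((v :: l).map lam).sum +
        sSup {c | ∃ u, (v :: l).getLast? = some u ∧ ∃ x, child u x ∧ c = beta x} := by
    intro v
    induction v using hwf.induction with
    | _ v ih =>
    by_cases hv : terminal v ∨ ∀ w, ¬ child v w
    · refine ⟨[], by simp, by simp, ?_, ?_⟩
      · intro u hu
        simp at hu
        exact hu ▸ hv
      · rw [hend v hv]
        simp
    · push Not at hv
      obtain ⟨hv, hc⟩ := hv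
      have hne : {b | ∃ w, child v w ∧ b = beta w}.Nonempty := by
        obtain ⟨w, hw⟩ := hc
        exact ⟨_, w, hw, rfl⟩
      obtain ⟨w, hw, hb⟩ := csInf_mem hne
      obtain ⟨l, h1, h2, h3, h4⟩ := ih w hw
      refine ⟨w :: l, List.isChain_cons_cons.2 ⟨hw, h1⟩, ?_, ?_, ?_⟩
      · intro u hu
        rw [List.dropLast_cons_cons, List.mem_cons] at hu
        rcases hu with rfl | hu
        · exact hv
        · exact h2 u hu
      · intro u hu
        rw [List.getLast?_cons_cons] at hu
        exact h3 u hu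
      · rw [hnonterm v hv hc, hb, h4, List.map_cons (l := w :: l), List.sum_cons (l := List.map _ _),
          add_assoc, List.getLast?_cons_cons]
  intro v
  apply le_antisymm
  · apply le_sInf
    rintro b ⟨p, hp, hh, h1, h2, h3, rfl⟩
    cases p with
    | nil => exact absurd rfl hp
    | cons a l =>
      simp only [List.head?_cons, Option.some.injEq] at hh
      subst hh
      exact hlow l a h1 h2 h3
  · obtain ⟨l, h1, h2, h3, h4⟩ := hatt v
    exact sInf_le ⟨v :: l, by simp, by simp, h1, h2, h3, h4⟩
end

section
/- For every node v ∈ V and every W ∈ ℕ, we have β(v) ≥ W if and only if Ψ((v), W) holds, where (v) denotes the singleton path consisting of just the node v. -/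
/-- `Q` is a term-complete extension of the nonempty path `P`: `Q` is a path
extending `P`, every node of `Q` strictly before its last node and at or after
the last node of `P` is not terminal, and the last node of `Q` is terminal or
has no children. -/
def TermCompleteExt {V : Type*} (child : V → V → Prop) (terminal : V → Prop)
    (P Q : List V) : Prop :=
  Q ≠ [] ∧ Q.Chain' child ∧ P <+: Q ∧
    (∀ u ∈ (Q.drop (P.length - 1)).dropLast, ¬ terminal u) ∧
    (∀ u, Q.getLast? = some u → terminal u ∨ ∀ w, ¬ child u w)

theorem tce_aux {V : Type*} (child : V → V → Prop) (terminal : V → Prop)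
    (R : List V) (v : V) (Q : List V) :
    TermCompleteExt child terminal (R ++ [v]) Q ↔
      ∃ T, Q = R ++ v :: T ∧ List.IsChain child (R ++ v :: T) ∧
        (∀ u ∈ (v :: T).dropLast, ¬ terminal u) ∧
        (∀ u, (v :: T).getLast? = some u → terminal u ∨ ∀ w, ¬ child u w) := by
  unfold TermCompleteExt
  constructor
  · rintro ⟨_, h2, ⟨T, rfl⟩, h4, h5⟩
    have h2 : List.IsChain child (R ++ [v] ++ T) := h2
    refine ⟨T, by simp, by simpa using h2, ?_, ?_⟩
    · simpa using h4
    · simpa [List.getLast?_append] using h5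
  · rintro ⟨T, rfl, h2, h4, h5⟩
    refine ⟨by simp, h2, ⟨T, by simp⟩, ?_, ?_⟩
    · simpa using h4
    · simpa [List.getLast?_append] using h5

theorem tce_stop {V : Type*} (child : V → V → Prop) (terminal : V → Prop)
    (R : List V) (v : V) (Q : List V) (hc : List.IsChain child (R ++ [v]))
    (hv : terminal v ∨ ∀ w, ¬ child v w) :
    TermCompleteExt child terminal (R ++ [v]) Q ↔ Q = R ++ [v] := by
  rw [tce_aux]
  constructor
  · rintro ⟨T, rfl, h2, h4, h5⟩
    cases T with
    | nil => rfl
    | cons x T =>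
      exfalso
      rcases hv with hv | hv
      · exact h4 v (by simp) hv
      · have := (List.isChain_append.1 h2).2.1
        exact hv x (List.isChain_cons_cons.1 this).1
  · rintro rfl
    exact ⟨[], rfl, hc, by simp, by simpa using hv⟩

theorem tce_step {V : Type*} (child : V → V → Prop) (terminal : V → Prop)
    (R : List V) (v : V) (Q : List V)
    (hv : ¬ terminal v) (hch : ∃ w, child v w) :
    TermCompleteExt child terminal (R ++ [v]) Q ↔
      ∃ x, child v x ∧ TermCompleteExt child terminal ((R ++ [v]) ++ [x]) Q := by
  simp only [tce_aux]
  constructor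
  · rintro ⟨T, rfl, h2, h4, h5⟩
    cases T with
    | nil =>
      obtain ⟨w, hw⟩ := hch
      rcases h5 v rfl with h | h
      · exact (hv h).elim
      · exact (h w hw).elim
    | cons x T =>
      have := (List.isChain_append.1 h2).2.1
      refine ⟨x, (List.isChain_cons_cons.1 this).1, T, by simp, by simpa using h2, ?_, ?_⟩
      · intro u hu
        exact h4 u (by simp only [List.dropLast_cons_cons]; exact List.mem_cons_of_mem _ hu)
      · intro u hu
        exact h5 u (by rw [List.getLast?_cons_cons]; exact hu)
  · rintro ⟨x, hx, T, rfl, h2, h4, h5⟩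
    refine ⟨x :: T, by simp, by simpa using h2, ?_, ?_⟩
    · intro u hu
      simp only [List.dropLast_cons_cons, List.mem_cons] at hu
      rcases hu with rfl | hu
      · exact hv
      · exact h4 u hu
    · intro u hu
      rw [List.getLast?_cons_cons] at hu
      exact h5 u hu

theorem stmt11 {V : Type*} [Fintype V] (child : V → V → Prop) (terminal : V → Prop)
    (hwf : WellFounded fun w v => child v w)
    (lam beta : V → ℕ∞)
    -- `beta` satisfies the defining recursion of the bottom-up timer:
    (hleaf : ∀ v, (¬ ∃ w, child v w) → beta v = lam v)
    (hterm : ∀ v, terminal v → (∃ w, child v w) →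
      beta v = lam v + sSup {b | ∃ w, child v w ∧ b = beta w})
    (hnonterm : ∀ v, ¬ terminal v → (∃ w, child v w) →
      beta v = lam v + sInf {b | ∃ w, child v w ∧ b = beta w})
    -- `Psi` satisfies the defining recursion of the predicate `Ψ`:
    (Psi : List V → ℕ → Prop)
    (hPsi : ∀ (P : List V), P ≠ [] → ∀ W : ℕ,
      (Psi P W ↔ ∀ Q : List V, TermCompleteExt child terminal P Q →
        (Q.map lam).sum < (W : ℕ∞) →
        ∃ x, (∃ u, Q.getLast? = some u ∧ child u x) ∧ Psi (Q ++ [x]) W)) :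
    ∀ (v : V) (W : ℕ), (W : ℕ∞) ≤ beta v ↔ Psi [v] W := by
  suffices H : ∀ (v : V) (R : List V) (W : ℕ), List.IsChain child (R ++ [v]) →
      ((W : ℕ∞) ≤ (R.map lam).sum + beta v ↔ Psi (R ++ [v]) W) by
    intro v W
    simpa using H v [] W (by simp)
  intro v
  induction v using hwf.induction with
  | _ v ih =>
  intro R W hc
  have hc' : ∀ x, child v x → List.IsChain child ((R ++ [v]) ++ [x]) := by
    intro x hx
    rw [List.isChain_append]
    refine ⟨hc, by simp, ?_⟩
    simpa using hx
  have ih' : ∀ x, child v x →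
      ((W : ℕ∞) ≤ (R.map lam).sum + lam v + beta x ↔ Psi ((R ++ [v]) ++ [x]) W) := by
    intro x hx
    simpa using ih x hx (R ++ [v]) W (hc' x hx)
  have hfin : {b | ∃ w, child v w ∧ b = beta w}.Finite :=
    (Set.finite_range beta).subset (by rintro b ⟨w, _, rfl⟩; exact ⟨w, rfl⟩)
  by_cases hch : ∃ w, child v w
  · have hne : {b | ∃ w, child v w ∧ b = beta w}.Nonempty := by
      obtain ⟨w, hw⟩ := hch
      exact ⟨_, w, hw, rfl⟩
    by_cases ht : terminal v
    · rw [hPsi _ (by simp) W, hterm v ht hch, ← add_assoc]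
      simp only [tce_stop child terminal R v _ hc (Or.inl ht), forall_eq]
      constructor
      · intro h _
        obtain ⟨w, hw, hb⟩ := hne.csSup_mem hfin
        rw [hb] at h
        exact ⟨w, ⟨v, by simp, hw⟩, (ih' w hw).1 h⟩
      · intro h
        by_cases hlt : ((R ++ [v]).map lam).sum < (W : ℕ∞)
        · obtain ⟨x, ⟨u, hu, hx⟩, hp⟩ := h hlt
          have huv : v = u := by simpa using hu
          subst huv
          refine ((ih' x hx).2 hp).trans ?_
          gcongr
          exact le_sSup ⟨x, hx, rfl⟩
        · refine le_trans ?_ le_self_add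
          simpa using hlt
    · have key : Psi (R ++ [v]) W ↔ ∀ x, child v x → Psi ((R ++ [v]) ++ [x]) W := by
        rw [hPsi _ (by simp) W]
        simp only [tce_step child terminal R v _ ht hch]
        constructor
        · intro h x hx
          rw [hPsi _ (by simp) W]
          intro Q hQ
          exact h Q ⟨x, hx, hQ⟩
        · rintro h Q ⟨x, hx, hQ⟩
          exact (hPsi _ (by simp) W).1 (h x hx) Q hQ
      rw [key, hnonterm v ht hch, ← add_assoc]
      constructor
      · intro h x hx
        refine (ih' x hx).1 (h.trans ?_)
        gcongr
        exact sInf_le ⟨x, hx, rfl⟩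
      · intro h
        obtain ⟨w, hw, hb⟩ := hne.csInf_mem hfin
        rw [hb]
        exact (ih' w hw).2 (h w hw)
  · rw [hPsi _ (by simp) W, hleaf v hch]
    simp only [tce_stop child terminal R v _ hc (Or.inr (not_exists.1 hch)), forall_eq]
    constructor
    · intro h hlt
      exact absurd hlt (by simpa using h)
    · intro h
      by_contra hlt
      obtain ⟨x, ⟨u, hu, hx⟩, _⟩ := h (by simpa using hlt)
      have huv : v = u := by simpa using hu
      subst huv
      exact hch ⟨x, hx⟩
end

section
/- Let S, G_root, G_bisect, G_proof, G_update, k and b be nonnegative real numbers, let ρ ≥ 1, and let N_A be a real number with N_A ≥ 1 and b ≤ N_A·k. If S + G_root ≥ ρ·(G_proof + (k + 1)·G_update + G_bisect) + (ρ − 1)·k·G_bisect, then N_A·(S + G_root) + b·G_bisect ≥ ρ·(N_A·(G_proof + (k + 1)·G_update) + (b + 1)·G_bisect). (Consequently, under this condition on the stake S, the resource ratio of adversarial staking-plus-gas costs to the honest party's marginal gas costs in single-level BoLD is at least ρ.) -/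
theorem stmt13 (S Groot Gbisect Gproof Gupdate k b NA ρ : ℝ)
    (hS : 0 ≤ S) (hGroot : 0 ≤ Groot) (hGbisect : 0 ≤ Gbisect)
    (hGproof : 0 ≤ Gproof) (hGupdate : 0 ≤ Gupdate)
    (hk : 0 ≤ k) (hb : 0 ≤ b) (hρ : 1 ≤ ρ) (hNA : 1 ≤ NA)
    (hbk : b ≤ NA * k)
    (h : ρ * (Gproof + (k + 1) * Gupdate + Gbisect) + (ρ - 1) * k * Gbisect ≤
      S + Groot) :
    ρ * (NA * (Gproof + (k + 1) * Gupdate) + (b + 1) * Gbisect) ≤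
      NA * (S + Groot) + b * Gbisect := by
  have h1 := mul_le_mul_of_nonneg_left h (by linarith : (0:ℝ) ≤ NA)
  have h2 : 0 ≤ (ρ - 1) * Gbisect * (NA * k - b) :=
    mul_nonneg (mul_nonneg (by linarith) hGbisect) (by linarith)
  have h3 : 0 ≤ ρ * Gbisect * (NA - 1) :=
    mul_nonneg (mul_nonneg (by linarith) hGbisect) (by linarith)
  linarith
end

section
/- Let v and v' be nonterminal nodes whose lspan values are even and divide their respective lbase values. Let w be a bisection child (left or right) of v and let w' be a bisection child (left or right) of v'. If w and w' have the same position, then either both w and w' are left children of their respective parents, or both are right children of their respective parents. -/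
/-- The position of a node: its level, base length, and span length. -/
def Node.position {X : Type} (v : Node X) : ℕ × ℕ × ℕ :=
  (v.level, v.lbase, v.lspan)

/-- `w` is the left bisection child of the nonterminal node `v`. -/
def IsLeftChild {X : Type} (H : X × X → X) (w v : Node X) : Prop :=
  1 < v.lspan ∧ ∃ spanL spanR, v.span = H (spanL, spanR) ∧ w = leftChild v spanL

/-- `w` is the right bisection child of the nonterminal node `v`. -/
def IsRightChild {X : Type} (H : X × X → X) (w v : Node X) : Prop :=
  1 < v.lspan ∧ ∃ spanL spanR, v.span = H (spanL, spanR) ∧ w = rightChild H v spanL spanR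

theorem stmt17 {X : Type} (H : X × X → X)
    (v v' w w' : Node X)
    (hv : 1 < v.lspan) (hv' : 1 < v'.lspan)
    (heven : 2 ∣ v.lspan) (heven' : 2 ∣ v'.lspan)
    (hdvd : v.lspan ∣ v.lbase) (hdvd' : v'.lspan ∣ v'.lbase)
    (hw : IsLeftChild H w v ∨ IsRightChild H w v)
    (hw' : IsLeftChild H w' v' ∨ IsRightChild H w' v')
    (hpos : w.position = w'.position) :
    (IsLeftChild H w v ∧ IsLeftChild H w' v') ∨
    (IsRightChild H w v ∧ IsRightChild H w' v') := by
  rcases hw with h | h <;> rcases hw' with h' | h'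
  · exact Or.inl ⟨h, h'⟩
  · exfalso
    obtain ⟨_, a, b, _, rfl⟩ := h
    obtain ⟨_, c, d, _, rfl⟩ := h'
    simp only [Node.position, leftChild, rightChild, Prod.mk.injEq] at hpos
    obtain ⟨_, h1, h2⟩ := hpos
    have e : v.lspan = v'.lspan := by omega
    rw [e, h1] at hdvd
    have := Nat.le_of_dvd (by omega) ((Nat.dvd_add_right hdvd').1 hdvd)
    omega
  · exfalso
    obtain ⟨_, a, b, _, rfl⟩ := h
    obtain ⟨_, c, d, _, rfl⟩ := h'
    simp only [Node.position, leftChild, rightChild, Prod.mk.injEq] at hpos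
    obtain ⟨_, h1, h2⟩ := hpos
    have e : v'.lspan = v.lspan := by omega
    rw [e, ← h1] at hdvd'
    have := Nat.le_of_dvd (by omega) ((Nat.dvd_add_right hdvd).1 hdvd')
    omega
  · exact Or.inr ⟨h, h'⟩
end
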